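/- Let 𝓕_k = {x ↦ F(x)_k} be the class of k-th output coordinates of L'-layer networks F(x) = W'_{L'} σ'_{L'−1}(··· σ'_1(W'_1 x)···) with 1-Lipschitz positive-homogeneous elementwise activations, ‖W'_l‖_F ≤ M'_l for l < L', ‖(W'_{L'})_k‖₂ ≤ M'_{L',k}, and ‖x‖₂ ≤ c₈. Then the Rademacher complexity satisfies R_m(𝓕_k) ≤ c₈(√(2 log(2) L') + 1)(∏_{l=1}^{L'−1} M'_l) M'_{L',k} / √m. -/

import Mathlib

open MeasureTheory

/-- Frobenius norm of a matrix. -/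
noncomputable def frob {D d : ℕ} (W : Matrix (Fin D) (Fin d) ℝ) : ℝ :=
  Real.sqrt (∑ i, ∑ j, (W i j) ^ 2)

/-- Hidden representations of a feed-forward network. -/
noncomputable def netHidden (n : ℕ → ℕ) (sig : ℕ → ℝ → ℝ)
    (W : ∀ l, Matrix (Fin (n (l + 1))) (Fin (n l)) ℝ) :
    ∀ l, (Fin (n 0) → ℝ) → Fin (n l) → ℝ
  | 0, y => y
  | l + 1, y => fun j => sig l ((W l).mulVec (netHidden n sig W l y) j)

noncomputable def sgn (b : Bool) : ℝ := if b then (1:ℝ) else -1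

lemma sgn_not (b : Bool) : sgn (!b) = - sgn b := by cases b <;> simp [sgn]

lemma exp_diff_mono {x y d e : ℝ} (hxy : x ≤ y) (hd : 0 ≤ d) (hde : d ≤ e) :
    Real.exp (x + d) - Real.exp x ≤ Real.exp (y + e) - Real.exp y := by
  have h1 : Real.exp x ≤ Real.exp y := Real.exp_le_exp.2 hxy
  have h2 : Real.exp d ≤ Real.exp e := Real.exp_le_exp.2 hde
  have h3 : 1 ≤ Real.exp d := Real.one_le_exp hd
  rw [Real.exp_add, Real.exp_add]
  nlinarith [Real.exp_pos x, Real.exp_pos y]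

lemma two_cosh_le {b p s : ℝ} (h : |p| ≤ |s|) :
    Real.exp (b + p) + Real.exp (b - p) ≤ Real.exp (b + s) + Real.exp (b - s) := by
  have := Real.cosh_le_cosh.2 h
  rw [Real.cosh_eq, Real.cosh_eq] at this
  simp only [sub_eq_add_neg, Real.exp_add]
  nlinarith [Real.exp_pos b]

lemma contr_pos {b b' p p' s s' U V : ℝ} (hp : |p| ≤ s) (hp' : |p'| ≤ s')
    (hpp : |p - p'| ≤ |s - s'|)
    (hU : Real.exp (b + s) ≤ U) (hU' : Real.exp (b' + s') ≤ U)
    (hV : Real.exp (b - s) ≤ V) (hV' : Real.exp (b' - s') ≤ V) 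
    (ha : b' + p' ≤ b + p) (hb : b - p ≤ b' - p') :
    Real.exp (b + p) + Real.exp (b' - p') ≤ U + V := by
  rw [abs_le] at hp hp' hpp
  rcases le_total s' s with h | h
  · rw [abs_of_nonneg (by linarith)] at hpp
    have := exp_diff_mono (x := b' - s') (y := b + p) (d := s' - p') (e := s - p)
      (by linarith) (by linarith) (by linarith)
    rw [show b' - s' + (s' - p') = b' - p' by ring, show b + p + (s - p) = b + s by ring] at this
    linarith
  · rw [abs_of_nonpos (by linarith)] at hpp
    have := exp_diff_mono (x := b - s) (y := b' - p') (d := s + p) (e := s' + p')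
      (by linarith) (by linarith) (by linarith)
    rw [show b - s + (s + p) = b + p by ring, show b' - p' + (s' + p') = b' + s' by ring] at this
    linarith

lemma contr_real {b b' p p' s s' U V : ℝ} (hp : |p| ≤ |s|) (hp' : |p'| ≤ |s'|)
    (hpp : |p - p'| ≤ |s - s'|)
    (hU : Real.exp (b + s) ≤ U) (hU' : Real.exp (b' + s') ≤ U)
    (hV : Real.exp (b - s) ≤ V) (hV' : Real.exp (b' - s') ≤ V) :
    Real.exp (b + p) + Real.exp (b' - p') ≤ U + V := by
  by_cases ha : b' + p' ≤ b + p
  swap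
  · have := Real.exp_le_exp.2 (not_le.1 ha).le
    linarith [two_cosh_le (b := b') hp']
  by_cases hb : b - p ≤ b' - p'
  swap
  · have := Real.exp_le_exp.2 (not_le.1 hb).le
    linarith [two_cosh_le (b := b) hp]
  rcases le_total 0 s with h | h <;> rcases le_total 0 s' with h' | h'
  · rw [abs_of_nonneg h] at hp
    rw [abs_of_nonneg h'] at hp'
    exact contr_pos hp hp' hpp hU hU' hV hV' ha hb
  · rw [abs_of_nonneg h, abs_le] at hp
    rw [abs_of_nonpos h', abs_le] at hp'
    have h1 : Real.exp (b + p) ≤ Real.exp (b + s) := Real.exp_le_exp.2 (by linarith)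
    have h2 : Real.exp (b' - p') ≤ Real.exp (b' - s') := Real.exp_le_exp.2 (by linarith)
    linarith
  · rw [abs_of_nonpos h, abs_le] at hp
    rw [abs_of_nonneg h', abs_le] at hp'
    have h1 : Real.exp (b + p) ≤ Real.exp (b - s) := Real.exp_le_exp.2 (by linarith)
    have h2 : Real.exp (b' - p') ≤ Real.exp (b' + s') := Real.exp_le_exp.2 (by linarith)
    linarith
  · rw [abs_of_nonpos h] at hp
    rw [abs_of_nonpos h'] at hp'
    have := contr_pos (b := b) (b' := b') (p := p) (p' := p') (s := -s) (s' := -s') (U := V) (V := U)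
      hp hp'
      (by rw [show -s - -s' = -(s - s') by ring, abs_neg]; exact hpp)
      (by simpa [sub_eq_add_neg] using hV) (by simpa [sub_eq_add_neg] using hV')
      (by simpa using hU) (by simpa using hU') ha hb
    linarith

lemma contr_step {ι : Type*} [Nonempty ι] (b p s : ι → ℝ) (hp : ∀ a, |p a| ≤ |s a|)
    (hpp : ∀ a a', |p a - p a'| ≤ |s a - s a'|) :
    (⨆ a, ENNReal.ofReal (Real.exp (b a + p a))) + (⨆ a, ENNReal.ofReal (Real.exp (b a - p a))) ≤
    (⨆ a, ENNReal.ofReal (Real.exp (b a + s a))) + (⨆ a, ENNReal.ofReal (Real.exp (b a - s a))) := by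
  apply ENNReal.iSup_add_iSup_le
  intro a a'
  have hU := fun a => le_iSup (fun a => ENNReal.ofReal (Real.exp (b a + s a))) a
  have hV := fun a => le_iSup (fun a => ENNReal.ofReal (Real.exp (b a - s a))) a
  generalize (⨆ a, ENNReal.ofReal (Real.exp (b a + s a))) = U at *
  generalize (⨆ a, ENNReal.ofReal (Real.exp (b a - s a))) = V at *
  by_cases h1 : U = ⊤
  · simp [h1]
  by_cases h2 : V = ⊤
  · simp [h2]
  simp only [ENNReal.ofReal_le_iff_le_toReal h1] at hU
  simp only [ENNReal.ofReal_le_iff_le_toReal h2] at hV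
  rw [← ENNReal.ofReal_add (Real.exp_pos _).le (Real.exp_pos _).le,
    ENNReal.ofReal_le_iff_le_toReal (by simp [h1, h2]), ENNReal.toReal_add h1 h2]
  exact contr_real (hp a) (hp a') (hpp a a') (hU a) (hU a') (hV a) (hV a')

lemma sum_cons {M : Type*} [AddCommMonoid M] {m : ℕ} (f : (Fin (m+1) → Bool) → M) :
    ∑ σ, f σ = ∑ τ : Fin m → Bool, (f (Fin.cons true τ) + f (Fin.cons false τ)) := by
  rw [← (Fin.consEquiv (fun _ : Fin (m+1) => Bool)).sum_comp, Fintype.sum_prod_type]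
  simp [Fin.consEquiv, Finset.sum_add_distrib]

lemma contraction {ι : Type*} [Nonempty ι] : ∀ (m : ℕ) (b : ι → ℝ) (w v : ι → Fin m → ℝ)
    (_ : ∀ a i, |w a i| ≤ |v a i|) (_ : ∀ a a' i, |w a i - w a' i| ≤ |v a i - v a' i|),
    ∑ σ : Fin m → Bool, (⨆ a, ENNReal.ofReal (Real.exp (b a + ∑ i, sgn (σ i) * w a i))) ≤
    ∑ σ : Fin m → Bool, (⨆ a, ENNReal.ofReal (Real.exp (b a + ∑ i, sgn (σ i) * v a i)))
  | 0, b, w, v, _, _ => by simp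
  | m+1, b, w, v, h1, h2 => by
    rw [sum_cons, sum_cons]
    simp only [Fin.sum_univ_succ, Fin.cons_zero, Fin.cons_succ]
    have e1 : ∀ x : ℝ, sgn true * x = x := by simp [sgn]
    have e2 : ∀ x : ℝ, sgn false * x = -x := by simp [sgn]
    simp only [e1, e2]
    calc _ ≤ ∑ τ : Fin m → Bool, 
          ((⨆ a, ENNReal.ofReal (Real.exp ((b a + v a 0) + ∑ i : Fin m, sgn (τ i) * w a i.succ))) +
          (⨆ a, ENNReal.ofReal (Real.exp ((b a - v a 0) + ∑ i : Fin m, sgn (τ i) * w a i.succ)))) := by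
          apply Finset.sum_le_sum
          intro τ _
          refine (le_of_eq ?_).trans ((contr_step
            (fun a => b a + ∑ i : Fin m, sgn (τ i) * w a i.succ) (fun a => w a 0)
            (fun a => v a 0) (fun a => h1 a 0) (fun a a' => h2 a a' 0)).trans (le_of_eq ?_)) <;>
          congr 1 <;> refine iSup_congr fun a => ?_ <;> congr 2 <;> ring
      _ ≤ _ := by
          rw [Finset.sum_add_distrib, Finset.sum_add_distrib]
          have i1 := contraction m (fun a => b a + v a 0) (fun a i => w a i.succ)
            (fun a i => v a i.succ) (fun a i => h1 a _) (fun a a' i => h2 a a' _)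
          have i2 := contraction m (fun a => b a - v a 0) (fun a i => w a i.succ)
            (fun a i => v a i.succ) (fun a i => h1 a _) (fun a a' i => h2 a a' _)
          refine (add_le_add i1 i2).trans (le_of_eq ?_)
          congr 1 <;> refine Finset.sum_congr rfl fun τ _ => iSup_congr fun a => ?_ <;> 
            congr 2 <;> ring

lemma pow_conv {a b B : ℝ} (hb : |b| ≤ B) (hB : B ≤ a) (k : ℕ) :
    (a + b)^k + (a - b)^k ≤ (a + B)^k + (a - B)^k := by
  rcases (abs_nonneg b).trans hb |>.eq_or_lt with h0 | h0
  · subst h0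
    have : b = 0 := by simpa using hb
    simp [this]
  have hc := convexOn_pow (𝕜 := ℝ) k
  rw [abs_le] at hb
  have m1 : a + B ∈ Set.Ici (0:ℝ) := by simp; linarith
  have m2 : a - B ∈ Set.Ici (0:ℝ) := by simp; linarith
  have t1 : 0 ≤ (B + b) / (2*B) := div_nonneg (by linarith) (by linarith)
  have t2 : 0 ≤ (B - b) / (2*B) := div_nonneg (by linarith) (by linarith)
  have t3 : (B + b) / (2*B) + (B - b) / (2*B) = 1 := by field_simp; ring
  have c1 := hc.2 m1 m2 t1 t2 t3
  have c2 := hc.2 m2 m1 t1 t2 t3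
  simp only [smul_eq_mul] at c1 c2
  rw [show (B + b) / (2*B) * (a + B) + (B - b) / (2*B) * (a - B) = a + b by field_simp; ring] at c1
  rw [show (B + b) / (2*B) * (a - B) + (B - b) / (2*B) * (a + B) = a - b by field_simp; ring] at c2
  have : (B + b) / (2*B) * (a+B)^k + (B - b) / (2*B) * (a+B)^k = (a+B)^k := by rw [← add_mul, t3, one_mul]
  have : (B + b) / (2*B) * (a-B)^k + (B - b) / (2*B) * (a-B)^k = (a-B)^k := by rw [← add_mul, t3, one_mul]
  linarith

lemma cosh_step {E : Type*} [NormedAddCommGroup E] [InnerProductSpace ℝ E] (x y : E) :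
    Real.cosh ‖x + y‖ + Real.cosh ‖x - y‖ ≤ 2 * (Real.cosh ‖x‖ * Real.cosh ‖y‖) := by
  have : 2 * (Real.cosh ‖x‖ * Real.cosh ‖y‖) = Real.cosh (‖x‖ + ‖y‖) + Real.cosh (‖x‖ - ‖y‖) := by
    rw [Real.cosh_add, Real.cosh_sub]; ring
  rw [this]
  refine hasSum_le (fun k => ?_) ((Real.hasSum_cosh ‖x+y‖).add (Real.hasSum_cosh ‖x-y‖))
    ((Real.hasSum_cosh (‖x‖+‖y‖)).add (Real.hasSum_cosh (‖x‖-‖y‖)))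
  rw [← add_div, ← add_div]
  refine div_le_div_of_nonneg_right ?_ (by positivity)
  simp only [pow_mul]
  rw [norm_add_sq_real, norm_sub_sq_real]
  have := pow_conv (a := ‖x‖^2 + ‖y‖^2) (b := 2 * inner ℝ x y) (B := 2 * (‖x‖ * ‖y‖))
    (by rw [abs_mul, abs_two]; gcongr; exact abs_real_inner_le_norm x y)
    (by nlinarith [sq_nonneg (‖x‖ - ‖y‖)]) k
  refine (le_of_eq ?_).trans (this.trans (le_of_eq ?_)) <;> congr 2 <;> ring

lemma cosh_sum {E : Type*} [NormedAddCommGroup E] [InnerProductSpace ℝ E] : ∀ (m : ℕ) (z : E)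
    (x : Fin m → E), ∑ σ : Fin m → Bool, Real.cosh ‖z + ∑ i, sgn (σ i) • x i‖ ≤
      2 ^ m * (Real.cosh ‖z‖ * ∏ i, Real.cosh ‖x i‖)
  | 0, z, x => by simp
  | m+1, z, x => by
    rw [sum_cons]
    simp only [Fin.sum_univ_succ, Fin.cons_zero, Fin.cons_succ, Finset.sum_add_distrib, 
      ← add_assoc, Fin.prod_univ_succ]
    have i1 := cosh_sum m (z + sgn true • x 0) (fun i => x i.succ)
    have i2 := cosh_sum m (z + sgn false • x 0) (fun i => x i.succ)
    have s := cosh_step z (x 0)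
    have e1 : z + sgn true • x 0 = z + x 0 := by simp [sgn]
    have e2 : z + sgn false • x 0 = z - x 0 := by simp [sgn, sub_eq_add_neg]
    rw [e1] at i1 ⊢
    rw [e2] at i2 ⊢
    refine (add_le_add i1 i2).trans ?_
    have hp : 0 ≤ ∏ i : Fin m, Real.cosh ‖x i.succ‖ := Finset.prod_nonneg fun i _ => (Real.cosh_pos _).le
    have := mul_le_mul_of_nonneg_left (mul_le_mul_of_nonneg_right s hp) (by positivity : (0:ℝ) ≤ 2^m)
    rw [pow_succ]
    linarith

lemma exp_sum {E : Type*} [NormedAddCommGroup E] [InnerProductSpace ℝ E] (m : ℕ)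
    (x : Fin m → E) : ∑ σ : Fin m → Bool, Real.exp ‖∑ i, sgn (σ i) • x i‖ ≤
      2 * 2 ^ m * Real.exp ((∑ i, ‖x i‖^2) / 2) := by
  have h := cosh_sum m 0 x
  simp only [zero_add, norm_zero, Real.cosh_zero, one_mul] at h
  have h2 : ∏ i, Real.cosh ‖x i‖ ≤ Real.exp ((∑ i, ‖x i‖^2) / 2) := by
    rw [Finset.sum_div, Real.exp_sum]
    exact Finset.prod_le_prod (fun i _ => (Real.cosh_pos _).le) fun i _ => Real.cosh_le_exp_half_sq _
  calc _ ≤ ∑ σ : Fin m → Bool, 2 * Real.cosh ‖∑ i, sgn (σ i) • x i‖ := by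
        refine Finset.sum_le_sum fun σ _ => ?_
        rw [Real.cosh_eq]
        linarith [Real.exp_pos (-‖∑ i, sgn (σ i) • x i‖)]
    _ ≤ _ := by
        rw [← Finset.mul_sum, mul_assoc]
        gcongr
        exact h.trans (by gcongr)

noncomputable def eN {d : ℕ} (y : Fin d → ℝ) : ℝ := Real.sqrt (∑ j, (y j) ^ 2)

lemma eN_eq {d : ℕ} (y : Fin d → ℝ) : eN y = ‖WithLp.toLp 2 y‖ := by
  simp [eN, EuclideanSpace.norm_eq]

lemma eN_nonneg {d : ℕ} (y : Fin d → ℝ) : 0 ≤ eN y := Real.sqrt_nonneg _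

lemma dot_le {d : ℕ} (u y : Fin d → ℝ) : u ⬝ᵥ y ≤ eN u * eN y := by
  unfold eN dotProduct
  exact Real.sum_mul_le_sqrt_mul_sqrt _ _ _

lemma sig_zero {f : ℝ → ℝ} (h : ∀ a t : ℝ, 0 ≤ a → f (a * t) = a * f t) : f 0 = 0 := by
  simpa using h 0 0 le_rfl

lemma eN_smul_inv {d : ℕ} (w : Fin d → ℝ) : eN ((eN w)⁻¹ • w) ≤ 1 := by
  rw [eN_eq ((eN w)⁻¹ • w), WithLp.toLp_smul, norm_smul, ← eN_eq, norm_inv, Real.norm_of_nonneg (eN_nonneg w)]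
  exact inv_mul_le_one

lemma eN_smul_cancel {d : ℕ} (w : Fin d → ℝ) : w = eN w • ((eN w)⁻¹ • w) := by
  by_cases h : eN w = 0
  · have h' := h
    rw [eN_eq, norm_eq_zero] at h
    have : w = 0 := by simpa using h
    simp [this]
  · rw [smul_smul, mul_inv_cancel₀ h, one_smul]

/-- reduction from a Frobenius-bounded matrix to a single unit vector -/
lemma exists_unit {D d m : ℕ} (W : Matrix (Fin D) (Fin d) ℝ) (M : ℝ) (hM : 0 ≤ M) (hW : frob W ≤ M)
    (f : ℝ → ℝ) (hf : ∀ a t : ℝ, 0 ≤ a → f (a * t) = a * f t) (y : Fin m → Fin d → ℝ)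
    (e : Fin m → ℝ) :
    ∃ u : Fin d → ℝ, eN u ≤ 1 ∧
      eN (fun j => ∑ i, e i * f (W.mulVec (y i) j)) ≤ M * |∑ i, e i * f (u ⬝ᵥ y i)| := by
  rcases Nat.eq_zero_or_pos D with hD | hD
  · subst hD
    refine ⟨0, by simp [eN], ?_⟩
    have : eN (fun j : Fin 0 => ∑ i, e i * f (W.mulVec (y i) j)) = 0 := by simp [eN]
    rw [this]; positivity
  have : Nonempty (Fin D) := ⟨⟨0, hD⟩⟩
  set U : Fin D → Fin d → ℝ := fun j => (eN (W j))⁻¹ • W j with hU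
  set Z : Fin D → ℝ := fun j => |∑ i, e i * f (U j ⬝ᵥ y i)| with hZ
  obtain ⟨j0, hj0⟩ := Finite.exists_max Z
  refine ⟨U j0, eN_smul_inv _, ?_⟩
  have key : ∀ j, (∑ i, e i * f (W.mulVec (y i) j))^2 ≤ (eN (W j))^2 * (Z j0)^2 := by
    intro j
    have h1 : ∑ i, e i * f (W.mulVec (y i) j) = eN (W j) * ∑ i, e i * f (U j ⬝ᵥ y i) := by
      rw [Finset.mul_sum]
      refine Finset.sum_congr rfl fun i _ => ?_
      have : W.mulVec (y i) j = eN (W j) * (U j ⬝ᵥ y i) := by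
        rw [Matrix.mulVec, ← smul_eq_mul, ← smul_dotProduct, hU]
        simp only
        rw [← eN_smul_cancel]
      rw [this, hf _ _ (eN_nonneg _)]; ring
    rw [h1, mul_pow]
    refine mul_le_mul_of_nonneg_left ?_ (sq_nonneg _)
    rw [← sq_abs]
    exact pow_le_pow_left₀ (abs_nonneg _) (hj0 j) 2
  have hfr : ∑ j, (eN (W j))^2 ≤ M^2 := by
    have : ∑ j, (eN (W j))^2 = (frob W)^2 := by
      unfold frob eN
      refine Eq.trans ?_ (Real.sq_sqrt
        (Finset.sum_nonneg fun i _ => Finset.sum_nonneg fun j _ => sq_nonneg (W i j))).symm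
      exact Finset.sum_congr rfl fun i _ => Real.sq_sqrt (Finset.sum_nonneg fun j _ => sq_nonneg _)
    rw [this]
    exact pow_le_pow_left₀ (Real.sqrt_nonneg _) hW 2
  unfold eN
  apply Real.sqrt_le_iff.2 ⟨by positivity, ?_⟩
  calc _ ≤ ∑ j, (eN (W j))^2 * (Z j0)^2 := Finset.sum_le_sum fun j _ => key j
    _ = (∑ j, (eN (W j))^2) * (Z j0)^2 := by rw [Finset.sum_mul]
    _ ≤ M^2 * (Z j0)^2 := by gcongr
    _ = _ := by rw [mul_pow]

section
variable (n : ℕ → ℕ) (sig : ℕ → ℝ → ℝ) (M : ℕ → ℝ) (D m : ℕ) (xs : Fin m → Fin (n 0) → ℝ)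

abbrev Idx := {W : ∀ l, Matrix (Fin (n (l + 1))) (Fin (n l)) ℝ // ∀ l < D, frob (W l) ≤ M l}

noncomputable def Q (l : ℕ) (lam : ℝ) (σ : Fin m → Bool) : ENNReal :=
  ⨆ W : Idx n M D, ENNReal.ofReal (Real.exp (lam *
    eN (fun j => ∑ i, sgn (σ i) * netHidden n sig W.1 l (xs i) j)))

lemma idx_nonempty (hM : ∀ l, 0 ≤ M l) : Nonempty (Idx n M D) :=
  ⟨⟨fun _ => 0, fun l _ => by simpa [frob] using hM l⟩⟩

lemma peel (hsig_lip : ∀ l, LipschitzWith 1 (sig l))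
    (hsig_hom : ∀ l (a t : ℝ), 0 ≤ a → sig l (a * t) = a * sig l t)
    (hM : ∀ l, 0 ≤ M l) (l : ℕ) (hl : l < D) (lam : ℝ) (hlam : 0 ≤ lam) :
    ∑ σ, Q n sig M D m xs (l+1) lam σ ≤ 2 * ∑ σ, Q n sig M D m xs l (lam * M l) σ := by
  have := idx_nonempty n M D hM
  let J := {u : Fin (n l) → ℝ // eN u ≤ 1} × Idx n M D
  have : Nonempty J := ⟨(⟨0, by simp [eN]⟩, Classical.arbitrary _)⟩
  have hc : 0 ≤ lam * M l := mul_nonneg hlam (hM l)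
  let v : J → Fin m → ℝ := fun a i => lam * M l * (a.1.1 ⬝ᵥ netHidden n sig a.2.1 l (xs i))
  let w : J → Fin m → ℝ := fun a i => lam * M l * sig l (a.1.1 ⬝ᵥ netHidden n sig a.2.1 l (xs i))
  let K : (Fin m → Bool) → ENNReal := fun σ =>
    ⨆ a : J, ENNReal.ofReal (Real.exp (0 + ∑ i, sgn (σ i) * w a i))
  have hlip : ∀ x y, |sig l x - sig l y| ≤ |x - y| := by
    intro x y
    have := (hsig_lip l).dist_le_mul x y
    simpa [Real.dist_eq] using this
  have hcon := contraction m (fun _ : J => 0) w v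
    (fun a i => by
      simp only [w, v]
      rw [abs_mul (lam * M l), abs_mul (lam * M l)]
      refine mul_le_mul_of_nonneg_left ?_ (abs_nonneg _)
      simpa [sig_zero (hsig_hom l)] using hlip (a.1.1 ⬝ᵥ netHidden n sig a.2.1 l (xs i)) 0)
    (fun a a' i => by
      simp only [w, v]
      rw [← mul_sub, ← mul_sub, abs_mul (lam * M l), abs_mul (lam * M l)]
      exact mul_le_mul_of_nonneg_left (hlip _ _) (abs_nonneg _))
  have h1 : ∀ σ, Q n sig M D m xs (l+1) lam σ ≤ K σ + K (fun i => !(σ i)) := by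
    intro σ
    refine iSup_le fun W => ?_
    obtain ⟨u, hu, hle⟩ := exists_unit (W.1 l) (M l) (hM l) (W.2 l hl) (sig l) (hsig_hom l)
      (fun i => netHidden n sig W.1 l (xs i)) (fun i => sgn (σ i))
    have k1 := le_iSup (fun a : J => ENNReal.ofReal (Real.exp (0 + ∑ i, sgn (σ i) * w a i)))
      (⟨u, hu⟩, W)
    have k2 := le_iSup (fun a : J => ENNReal.ofReal (Real.exp (0 + ∑ i, sgn (!(σ i)) * w a i)))
      (⟨u, hu⟩, W)
    refine le_trans ?_ (add_le_add k1 k2)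
    rw [← ENNReal.ofReal_add (Real.exp_pos _).le (Real.exp_pos _).le]
    apply ENNReal.ofReal_le_ofReal
    set z := ∑ i, sgn (σ i) * sig l (u ⬝ᵥ netHidden n sig W.1 l (xs i)) with hz
    have e1 : (0 + ∑ i, sgn (σ i) * w (⟨u, hu⟩, W) i) = lam * M l * z := by
      rw [zero_add, hz, Finset.mul_sum]
      exact Finset.sum_congr rfl fun i _ => by simp only [w]; ring
    have e2 : (0 + ∑ i, sgn (!(σ i)) * w (⟨u, hu⟩, W) i) = -(lam * M l * z) := by
      rw [zero_add, hz, Finset.mul_sum, ← Finset.sum_neg_distrib]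
      exact Finset.sum_congr rfl fun i _ => by simp only [w, sgn_not]; ring
    rw [e1, e2]
    have h3 : Real.exp (lam * eN (fun j => ∑ i, sgn (σ i) * netHidden n sig W.1 (l+1) (xs i) j))
        ≤ Real.exp |lam * M l * z| := by
      apply Real.exp_le_exp.2
      rw [abs_mul, abs_of_nonneg hc, mul_assoc]
      exact mul_le_mul_of_nonneg_left hle hlam
    refine h3.trans ?_
    rcases abs_cases (lam * M l * z) with h | h <;> rw [h.1]
    · linarith [Real.exp_pos (-(lam * M l * z))]
    · linarith [Real.exp_pos (lam * M l * z)]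
  have h2 : ∑ σ : Fin m → Bool, K (fun i => !(σ i)) = ∑ σ, K σ := by
    refine Fintype.sum_equiv (Function.Involutive.toPerm (fun (σ : Fin m → Bool) i => !(σ i))
      (fun σ => by simp)) _ _ (fun σ => rfl)
  calc _ ≤ ∑ σ, (K σ + K (fun i => !(σ i))) := Finset.sum_le_sum fun σ _ => h1 σ
    _ = 2 * ∑ σ, K σ := by rw [Finset.sum_add_distrib, h2, two_mul]
    _ ≤ _ := by
      gcongr 2 * ?_
      refine hcon.trans (Finset.sum_le_sum fun σ _ => iSup_le fun a => ?_)
      refine le_trans ?_ (le_iSup _ a.2)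
      apply ENNReal.ofReal_le_ofReal
      apply Real.exp_le_exp.2
      have : (0 + ∑ i, sgn (σ i) * v a i) = lam * M l *
          (a.1.1 ⬝ᵥ (fun j => ∑ i, sgn (σ i) * netHidden n sig a.2.1 l (xs i) j)) := by
        simp only [zero_add, v, dotProduct, Finset.mul_sum]
        rw [Finset.sum_comm]
        refine Finset.sum_congr rfl fun i _ => Finset.sum_congr rfl fun j _ => by ring
      rw [this]
      gcongr
      exact (dot_le _ _).trans (mul_le_of_le_one_left (eN_nonneg _) a.1.2)

lemma base (lam : ℝ) (hlam : 0 ≤ lam) :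
    ∑ σ, Q n sig M D m xs 0 lam σ ≤
      ENNReal.ofReal (2 * 2 ^ m * Real.exp (lam^2 * (∑ i, (eN (xs i))^2) / 2)) := by
  have h := exp_sum m (fun i => lam • WithLp.toLp 2 (xs i))
  have e : ∑ i, ‖lam • WithLp.toLp 2 (xs i)‖^2 = lam^2 * (∑ i, (eN (xs i))^2) := by
    rw [Finset.mul_sum]
    refine Finset.sum_congr rfl fun i _ => ?_
    rw [norm_smul, eN_eq, mul_pow, Real.norm_eq_abs, sq_abs]
  rw [e] at h
  refine le_trans ?_ (ENNReal.ofReal_le_ofReal h)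
  rw [ENNReal.ofReal_sum_of_nonneg (fun _ _ => (Real.exp_pos _).le)]
  refine Finset.sum_le_sum fun σ _ => iSup_le fun W => ?_
  apply ENNReal.ofReal_le_ofReal
  apply Real.exp_le_exp.2
  apply le_of_eq
  have : ∑ i, sgn (σ i) • lam • WithLp.toLp 2 (xs i) = 
      lam • WithLp.toLp 2 (fun j => ∑ i, sgn (σ i) * xs i j) := by
    ext j
    simp [Finset.mul_sum]
    exact Finset.sum_congr rfl fun i _ => by ring
  rw [this, norm_smul, Real.norm_of_nonneg hlam, ← eN_eq]
  rfl

lemma peel_all (hsig_lip : ∀ l, LipschitzWith 1 (sig l))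
    (hsig_hom : ∀ l (a t : ℝ), 0 ≤ a → sig l (a * t) = a * sig l t)
    (hM : ∀ l, 0 ≤ M l) (l : ℕ) : l ≤ D → ∀ (lam : ℝ), 0 ≤ lam →
    ∑ σ, Q n sig M D m xs l lam σ ≤ 2^l * ENNReal.ofReal (2 * 2 ^ m *
      Real.exp ((lam * ∏ j ∈ Finset.range l, M j)^2 * (∑ i, (eN (xs i))^2) / 2)) := by
  induction l with
  | zero => intro _ lam hlam; simpa using base n sig M D m xs lam hlam
  | succ l ih =>
    intro hl lam hlam
    refine (peel n sig M D m xs hsig_lip hsig_hom hM l hl lam hlam).trans ?_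
    refine (mul_le_mul_right (ih (by omega) (lam * M l) (mul_nonneg hlam (hM l))) 2).trans ?_
    rw [Finset.prod_range_succ, pow_succ (2:ENNReal), ← mul_assoc, mul_comm (2:ENNReal),
      show lam * M l * ∏ j ∈ Finset.range l, M j = lam * ((∏ j ∈ Finset.range l, M j) * M l) by ring]

end

lemma sum_log_le {α : Type*} [Fintype α] [Nonempty α] (q : α → ℝ) (hq : ∀ a, 0 < q a) (C : ℝ) (hC : 0 < C)
    (h : ∑ a, q a ≤ Fintype.card α * C) : ∑ a, Real.log (q a) ≤ Fintype.card α * Real.log C := by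
  have h1 : ∀ a, Real.log (q a) ≤ Real.log C + (q a / C - 1) := by
    intro a
    have := Real.log_le_sub_one_of_pos (div_pos (hq a) hC)
    rw [Real.log_div (hq a).ne' hC.ne'] at this
    linarith
  refine (Finset.sum_le_sum fun a _ => h1 a).trans ?_
  rw [Finset.sum_add_distrib, Finset.sum_sub_distrib, ← Finset.sum_div]
  have : (∑ a, q a) / C ≤ Fintype.card α := by rw [div_le_iff₀ hC]; exact h
  simp only [Finset.sum_const, Finset.card_univ, nsmul_eq_mul, mul_one]
  linarith

lemma det_bound (L' m : ℕ) (hL : 0 < L') (hm : 0 < m)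
    (n : ℕ → ℕ) (sig : ℕ → ℝ → ℝ)
    (hsig_lip : ∀ l, LipschitzWith 1 (sig l))
    (hsig_hom : ∀ l (a t : ℝ), 0 ≤ a → sig l (a * t) = a * sig l t)
    (M : ℕ → ℝ) (hM : ∀ l, 0 ≤ M l) (MLk c8 : ℝ) (hMLk : 0 ≤ MLk)
    (k : Fin (n ((L' - 1) + 1))) (xs : Fin m → Fin (n 0) → ℝ) (hc8 : 0 ≤ c8)
    (hxs : ∀ i, eN (xs i) ≤ c8) (B : ℝ) (hB : 0 < B) 
    (hB' : c8 * (∏ l ∈ Finset.range (L' - 1), M l) * MLk ≤ B) :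
    ((2 : ℝ) ^ m)⁻¹ * ∑ σ : Fin m → Bool,
          sSup {v : ℝ | ∃ W : ∀ l, Matrix (Fin (n (l + 1))) (Fin (n l)) ℝ,
            (∀ l < L' - 1, frob (W l) ≤ M l) ∧
            Real.sqrt (∑ j, (W (L' - 1) k j) ^ 2) ≤ MLk ∧
            v = (1 / m : ℝ) * ∑ i, (if σ i then (1:ℝ) else -1) *
                  (W (L' - 1)).mulVec (netHidden n sig W (L' - 1) (xs i)) k}
      ≤ B * Real.sqrt (2 * Real.log 2 * L') / Real.sqrt m := by
  obtain ⟨D, rfl⟩ : ∃ D, L' = D + 1 := ⟨L' - 1, by omega⟩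
  simp only [Nat.add_sub_cancel] at *
  have hmR : (0:ℝ) < m := by exact_mod_cast hm
  have hl2 : 0 < Real.log 2 := Real.log_pos (by norm_num)
  set K := Real.sqrt (2 * Real.log 2 * ((D + 1 : ℕ) : ℝ)) with hK
  have hKpos : 0 < K := Real.sqrt_pos.2 (by positivity)
  have hK2 : K ^ 2 = 2 * Real.log 2 * ((D + 1 : ℕ) : ℝ) := Real.sq_sqrt (by positivity)
  set s := Real.sqrt m with hs
  have hspos : 0 < s := Real.sqrt_pos.2 hmR
  have hs2 : s ^ 2 = m := Real.sq_sqrt hmR.le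
  set lam := K / (s * B) with hlam
  have hlampos : 0 < lam := by positivity
  set Pi := ∏ l ∈ Finset.range D, M l with hPi
  have hPi0 : 0 ≤ Pi := Finset.prod_nonneg fun l _ => hM l
  set C : ℝ := 2 ^ (D+1) * Real.exp (K^2 / 2) with hC
  have hCpos : 0 < C := by positivity
  set q := Q n sig M D m xs D (lam * MLk) with hq
  have hsum : ∑ σ, q σ ≤ ENNReal.ofReal (2 ^ m * C) := by
    refine (peel_all n sig M D m xs hsig_lip hsig_hom hM D le_rfl (lam * MLk) (by positivity)).trans ?_
    rw [show (2:ENNReal)^D = ENNReal.ofReal (2^D) by rw [ENNReal.ofReal_pow (by norm_num)]; simp,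
      ← ENNReal.ofReal_mul (by positivity)]
    apply ENNReal.ofReal_le_ofReal
    have : (lam * MLk * Pi)^2 * (∑ i, (eN (xs i))^2) ≤ K^2 := by
      have h1 : ∑ i, (eN (xs i))^2 ≤ m * c8^2 := by
        calc _ ≤ ∑ i : Fin m, c8^2 := Finset.sum_le_sum fun i _ =>
              pow_le_pow_left₀ (eN_nonneg _) (hxs i) 2
          _ = _ := by simp
      calc _ ≤ (lam * MLk * Pi)^2 * (m * c8^2) := by gcongr
        _ = (lam * s)^2 * (c8 * Pi * MLk)^2 := by rw [← hs2]; ring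
        _ ≤ (lam * s)^2 * B^2 := by gcongr
        _ = K^2 := by rw [hlam]; field_simp
    calc _ ≤ 2^D * (2 * 2^m * Real.exp (K^2/2)) := by gcongr
      _ = _ := by rw [hC, pow_succ]; ring
  have hfin : ∀ σ, q σ ≠ ⊤ := fun σ => ne_top_of_le_ne_top ENNReal.ofReal_ne_top
    ((Finset.single_le_sum (fun _ _ => zero_le) (Finset.mem_univ σ)).trans hsum)
  have hsumR : ∑ σ, (q σ).toReal ≤ 2 ^ m * C := by
    rw [← ENNReal.toReal_sum (fun σ _ => hfin σ)]
    exact ENNReal.toReal_le_of_le_ofReal (by positivity) hsum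
  have hge : ∀ σ (W : Idx n M D), Real.exp (lam * MLk *
      eN (fun j => ∑ i, sgn (σ i) * netHidden n sig W.1 D (xs i) j)) ≤ (q σ).toReal := by
    intro σ W
    rw [← ENNReal.ofReal_le_iff_le_toReal (hfin σ)]
    exact le_iSup (fun W : Idx n M D => ENNReal.ofReal (Real.exp (lam * MLk *
      eN (fun j => ∑ i, sgn (σ i) * netHidden n sig W.1 D (xs i) j)))) W
  obtain ⟨W0⟩ := idx_nonempty n M D hM
  have hqpos : ∀ σ, 0 < (q σ).toReal := fun σ => (Real.exp_pos _).trans_le (hge σ W0)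
  have hlog := sum_log_le (fun σ => (q σ).toReal) hqpos C hCpos (by simpa using hsumR)
  have hsup : ∀ σ : Fin m → Bool, sSup {v : ℝ | ∃ W : ∀ l, Matrix (Fin (n (l + 1))) (Fin (n l)) ℝ,
            (∀ l < D, frob (W l) ≤ M l) ∧
            Real.sqrt (∑ j, (W D k j) ^ 2) ≤ MLk ∧
            v = (1 / m : ℝ) * ∑ i, (if σ i then (1:ℝ) else -1) *
                  (W D).mulVec (netHidden n sig W D (xs i)) k} ≤ (lam * m)⁻¹ * Real.log (q σ).toReal := by
    intro σ
    refine csSup_le ⟨_, fun _ => 0, fun l _ => by simpa [frob] using hM l, by simpa using hMLk, rfl⟩ ?_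
    rintro v ⟨W, hW, hk, rfl⟩
    have h1 := (Real.le_log_iff_exp_le (hqpos σ)).2 (hge σ ⟨W, hW⟩)
    have h2 : ∑ i, (if σ i then (1:ℝ) else -1) * (W D).mulVec (netHidden n sig W D (xs i)) k
        = W D k ⬝ᵥ (fun j => ∑ i, sgn (σ i) * netHidden n sig W D (xs i) j) := by
      simp only [dotProduct, Matrix.mulVec, Finset.mul_sum]
      rw [Finset.sum_comm]
      refine Finset.sum_congr rfl fun i _ => Finset.sum_congr rfl fun j _ => by simp only [sgn]; ring
    have h3 : W D k ⬝ᵥ (fun j => ∑ i, sgn (σ i) * netHidden n sig W D (xs i) j) ≤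
        MLk * eN (fun j => ∑ i, sgn (σ i) * netHidden n sig W D (xs i) j) :=
      (dot_le _ _).trans (mul_le_mul_of_nonneg_right hk (eN_nonneg _))
    rw [h2]
    have h4 := (mul_le_mul_of_nonneg_left h3 hlampos.le).trans (by simpa [mul_assoc] using h1)
    have h5 := mul_le_mul_of_nonneg_left h4 (by positivity : 0 ≤ (lam * m)⁻¹)
    refine le_trans (le_of_eq ?_) h5
    field_simp
  calc _ ≤ ((2 : ℝ) ^ m)⁻¹ * ∑ σ : Fin m → Bool, (lam * m)⁻¹ * Real.log (q σ).toReal := by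
        gcongr with σ
        exact hsup σ
    _ ≤ ((2 : ℝ) ^ m)⁻¹ * ((lam * m)⁻¹ * (2^m * Real.log C)) := by
        rw [← Finset.mul_sum]
        gcongr
        simpa using hlog
    _ = (lam * m)⁻¹ * Real.log C := by field_simp
    _ = (lam * m)⁻¹ * K^2 := by
        rw [hC, Real.log_mul (by positivity) (by positivity), Real.log_exp, Real.log_pow]
        congr 1; linarith
    _ = B * K / s := by
        rw [hlam, ← hs2]
        field_simp

theorem stmt14 (L' m : ℕ) (hL : 0 < L') (hm : 0 < m)
    (n : ℕ → ℕ) (sig : ℕ → ℝ → ℝ)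
    (hsig_lip : ∀ l, LipschitzWith 1 (sig l))
    (hsig_hom : ∀ l (a t : ℝ), 0 ≤ a → sig l (a * t) = a * sig l t)
    (M : ℕ → ℝ) (hM : ∀ l, 0 ≤ M l) (MLk c8 : ℝ) (hMLk : 0 ≤ MLk)
    (k : Fin (n ((L' - 1) + 1)))
    (P : Measure (Fin (n 0) → ℝ)) [IsProbabilityMeasure P]
    (hP : ∀ᵐ x ∂P, Real.sqrt (∑ j, (x j) ^ 2) ≤ c8) :
    (∫ xs : Fin m → Fin (n 0) → ℝ,
        ((2 : ℝ) ^ m)⁻¹ * ∑ σ : Fin m → Bool,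
          sSup {v : ℝ | ∃ W : ∀ l, Matrix (Fin (n (l + 1))) (Fin (n l)) ℝ,
            (∀ l < L' - 1, frob (W l) ≤ M l) ∧
            Real.sqrt (∑ j, (W (L' - 1) k j) ^ 2) ≤ MLk ∧
            v = (1 / m : ℝ) * ∑ i, (if σ i then (1:ℝ) else -1) *
                  (W (L' - 1)).mulVec (netHidden n sig W (L' - 1) (xs i)) k}
      ∂(Measure.pi fun _ => P))
    ≤ c8 * (Real.sqrt (2 * Real.log 2 * L') + 1) *
        (∏ l ∈ Finset.range (L' - 1), M l) * MLk / Real.sqrt m := by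
  have hc8 : 0 ≤ c8 := by
    obtain ⟨x, hx⟩ := hP.exists
    exact (Real.sqrt_nonneg _).trans hx
  have hPi0 : 0 ≤ ∏ l ∈ Finset.range (L' - 1), M l := Finset.prod_nonneg fun l _ => hM l
  have hxs : ∀ᵐ xs ∂(Measure.pi fun _ : Fin m => P), ∀ i, eN (xs i) ≤ c8 := by
    rw [ae_all_iff]
    intro i
    exact (measurePreserving_eval (fun _ : Fin m => P) i).quasiMeasurePreserving.ae hP
  have hmR : (0:ℝ) < Real.sqrt m := Real.sqrt_pos.2 (by exact_mod_cast hm)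
  by_cases hInt : Integrable (fun xs : Fin m → Fin (n 0) → ℝ =>
        ((2 : ℝ) ^ m)⁻¹ * ∑ σ : Fin m → Bool,
          sSup {v : ℝ | ∃ W : ∀ l, Matrix (Fin (n (l + 1))) (Fin (n l)) ℝ,
            (∀ l < L' - 1, frob (W l) ≤ M l) ∧
            Real.sqrt (∑ j, (W (L' - 1) k j) ^ 2) ≤ MLk ∧
            v = (1 / m : ℝ) * ∑ i, (if σ i then (1:ℝ) else -1) *
                  (W (L' - 1)).mulVec (netHidden n sig W (L' - 1) (xs i)) k}) 
      (Measure.pi fun _ => P)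
  swap
  · rw [integral_undef hInt]
    positivity
  refine (integral_mono_ae hInt (integrable_const (c8 * (Real.sqrt (2 * Real.log 2 * L') + 1) *
        (∏ l ∈ Finset.range (L' - 1), M l) * MLk / Real.sqrt m)) ?_).trans
    (le_of_eq (by rw [integral_const, probReal_univ, one_smul]))
  filter_upwards [hxs] with xs hx
  apply le_of_forall_pos_le_add
  intro ε hε
  set K := Real.sqrt (2 * Real.log 2 * L') with hK
  have hK0 : 0 ≤ K := Real.sqrt_nonneg _
  have hδ : 0 < ε * Real.sqrt m / (K + 1) := by positivity
  have h := det_bound L' m hL hm n sig hsig_lip hsig_hom M hM MLk c8 hMLk k xs hc8 hx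
    (c8 * (∏ l ∈ Finset.range (L' - 1), M l) * MLk + ε * Real.sqrt m / (K + 1)) (by positivity)
    (by linarith)
  refine h.trans ?_
  rw [← hK]
  have : c8 * (K + 1) * (∏ l ∈ Finset.range (L' - 1), M l) * MLk / Real.sqrt m + ε
    = (c8 * (∏ l ∈ Finset.range (L' - 1), M l) * MLk + ε * Real.sqrt m / (K + 1)) * (K+1) / Real.sqrt m := by
    field_simp
  rw [this]
  gcongr
  linarith
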